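/- arXiv:2207.04247 — 2 statements merged into one kernel-verified Lean document; each statement's English description precedes it below -/
import Mathlib

section
/- Let (R, m) be a Noetherian local ring and B an R-algebra that is big Cohen-Macaulay with respect to some system of parameters x_1,...,x_d (i.e., x_1,...,x_d is a regular sequence on B). Then the m-adic completion of B is a balanced big Cohen-Macaulay R-algebra, i.e., every system of parameters of R is a regular sequence on the completion of B. -/
namespace BBCM
open RingTheory.Sequence
open scoped Pointwise

/-- Elementary form of derived `a`-completeness. -/
def DC {R : Type*} [CommRing R] (a : R) (M : Type*) [AddCommGroup M] [Module R M] : Prop :=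
  Function.Bijective (fun (m : ℕ → M) (n : ℕ) => m n - a • m (n + 1))

section dc
variable {R : Type*} [CommRing R] {M : Type*} [AddCommGroup M] [Module R M]
  {M' : Type*} [AddCommGroup M'] [Module R M']

lemma DC.zero_of {a : R} (h : DC a M) (m : ℕ → M) (hm : ∀ n, m n = a • m (n + 1)) (n : ℕ) :
    m n = 0 := by
  have : m = 0 := h.1 (by funext n; simp [← hm n])
  simp [this]

lemma DC.of_inj {a : R} (hs : Function.Surjective
    (fun (m : ℕ → M) (n : ℕ) => m n - a • m (n + 1)))
    (hz : ∀ m : ℕ → M, (∀ n, m n = a • m (n + 1)) → m = 0) : DC a M := by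
  refine ⟨fun m m' h => ?_, hs⟩
  have := hz (m - m') (fun n => by
    have := congrFun h n
    simp only [Pi.sub_apply, smul_sub] at this ⊢
    rw [sub_eq_sub_iff_sub_eq_sub] at this
    exact this)
  exact sub_eq_zero.mp this

lemma DC.congr {a : R} (h : DC a M) (e : M ≃ₗ[R] M') : DC a M' := by
  refine DC.of_inj (fun t => ?_) (fun m hm => ?_)
  · obtain ⟨s, hs⟩ := h.2 (fun n => e.symm (t n))
    refine ⟨fun n => e (s n), ?_⟩
    funext n
    have := congrArg e (congrFun hs n)
    simpa using this
  · funext n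
    have := h.zero_of (fun n => e.symm (m n)) (fun n => by
      rw [← map_smul, ← hm n]) n
    simpa using this

lemma DC.quotSMulTop {a : R} (h : DC a M) (b : R) : DC a (QuotSMulTop b M) := by
  refine DC.of_inj (fun t => ?_) (fun m hm => ?_)
  · choose t' ht' using fun n => Submodule.mkQ_surjective (b • ⊤ : Submodule R M) (t n)
    obtain ⟨s, hs⟩ := h.2 t'
    refine ⟨fun n => Submodule.mkQ _ (s n), ?_⟩
    funext n
    have := congrFun hs n
    simp only at this ⊢
    rw [← map_smul, ← map_sub, this, ht']
  · choose m' hm' using fun n => Submodule.mkQ_surjective (b • ⊤ : Submodule R M) (m n)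
    have key : ∀ n, ∃ t : M, b • t = m' n - a • m' (n + 1) := by
      intro n
      have h1 : Submodule.mkQ (b • ⊤ : Submodule R M) (m' n - a • m' (n + 1)) = 0 := by
        rw [map_sub, map_smul, hm', hm', ← hm n, sub_self]
      rw [Submodule.mkQ_apply, Submodule.Quotient.mk_eq_zero] at h1
      obtain ⟨t, -, ht⟩ := h1
      exact ⟨t, ht⟩
    choose t ht using key
    obtain ⟨s, hs⟩ := h.2 t
    have := h.zero_of (fun n => m' n - b • s n) (fun n => by
      have h2 := congrFun hs n
      simp only at h2
      rw [smul_sub, sub_eq_sub_iff_sub_eq_sub, ← ht n, ← h2, smul_sub, smul_comm a b])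
    funext n
    have h3 := sub_eq_zero.mp (this n)
    rw [← hm' n, h3, Submodule.mkQ_apply, Pi.zero_apply, Submodule.Quotient.mk_eq_zero]
    exact ⟨s n, trivial, rfl⟩

lemma DC.quot_ofList {a : R} (rs : List R) : ∀ {M : Type*} [AddCommGroup M] [Module R M],
    DC a M → DC a (M ⧸ (Ideal.ofList rs • ⊤ : Submodule R M)) := by
  induction rs with
  | nil =>
    intro M _ _ h
    exact h.congr (Submodule.quotEquivOfEqBot _ (by simp)).symm
  | cons r rs ih =>
    intro M _ _ h
    exact (ih (h.quotSMulTop r)).congr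
      (Submodule.quotOfListConsSMulTopEquivQuotSMulTopInner M r rs).symm

lemma perm_of_DC {rs rs' : List R} (hp : rs.Perm rs') (h : IsWeaklyRegular M rs)
    (hdc : ∀ a ∈ rs, DC a M) : IsWeaklyRegular M rs' := by
  refine h.prototype_perm hp ?_
  intro a b l hl K hK
  have ha : a ∈ rs := hl.subset (by simp)
  have hd := DC.quot_ofList l (hdc a ha)
  rw [eq_bot_iff]
  intro x hx
  have step : ∀ y : K, ∃ z : K, (y : M ⧸ (Ideal.ofList l • ⊤ : Submodule R M)) = a • z.1 := by
    intro y
    have : (y : M ⧸ (Ideal.ofList l • ⊤ : Submodule R M)) ∈ a • K := hK.le y.2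
    obtain ⟨z, hz, hz'⟩ := this
    exact ⟨⟨z, hz⟩, hz'.symm⟩
  choose f hf using step
  have := hd.zero_of (fun n => ((f^[n] ⟨x, hx⟩ : K) : M ⧸ (Ideal.ofList l • ⊤ : Submodule R M)))
    (fun n => by
      rw [Function.iterate_succ_apply', ← hf]) 0
  simpa using this

lemma replace_last {l : List R} {a w : R} {J : Ideal R} (hJ : ∀ j ∈ J, ∀ n : M, j • n = 0)
    (h : IsWeaklyRegular M (l ++ [a]))
    (ha : a ∈ (J ⊔ Ideal.ofList l ⊔ Ideal.span {w}).radical) :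
    IsWeaklyRegular M (l ++ [w]) := by
  rw [isWeaklyRegular_append_iff, isWeaklyRegular_singleton_iff] at h ⊢
  refine ⟨h.1, ?_⟩
  obtain ⟨n, hn⟩ := ha
  obtain ⟨ju, hju, cw, hcw, hsum⟩ := Submodule.mem_sup.mp hn
  obtain ⟨j, hj, u, hu, rfl⟩ := Submodule.mem_sup.mp hju
  obtain ⟨c, rfl⟩ := Ideal.mem_span_singleton'.mp hcw
  have h2 := h.2.pow n
  have : IsSMulRegular (M ⧸ (Ideal.ofList l • ⊤ : Submodule R M)) (c * w) := by
    intro p q hpq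
    apply h2
    simp only at hpq ⊢
    rw [← hsum, add_smul, add_smul, add_smul (j + u), add_smul j]
    have kill : ∀ p : M ⧸ (Ideal.ofList l • ⊤ : Submodule R M), j • p = 0 ∧ u • p = 0 := by
      intro p
      obtain ⟨p, rfl⟩ := Submodule.mkQ_surjective _ p
      refine ⟨by rw [← map_smul, hJ j hj, map_zero], ?_⟩
      rw [← map_smul, Submodule.mkQ_apply, Submodule.Quotient.mk_eq_zero]
      exact Submodule.smul_mem_smul hu trivial
    rw [(kill p).1, (kill p).2, (kill q).1, (kill q).2, hpq]
  exact this.of_mul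

end dc

section main
variable {R : Type*} [CommRing R] [IsNoetherianRing R] [IsLocalRing R]

open IsLocalRing

lemma radical_eq_of_avoid {I : Ideal R} {a w : R} 
    (h : (I ⊔ Ideal.span {a}).radical = maximalIdeal R) (hw : w ∈ maximalIdeal R)
    (hav : ∀ P ∈ I.minimalPrimes, w ∉ P) :
    (I ⊔ Ideal.span {w}).radical = maximalIdeal R := by
  have hle : I ⊔ Ideal.span {a} ≤ maximalIdeal R := h ▸ Ideal.le_radical
  apply le_antisymm
  · rw [(maximalIdeal.isMaximal R).isPrime.radical_le_iff]
    exact sup_le (le_sup_left.trans hle) (by simpa [Ideal.span_le] using hw)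
  · rw [Ideal.radical_eq_sInf]
    refine le_sInf ?_
    rintro P ⟨hP, hPp⟩
    by_contra hne
    have hPm : P < maximalIdeal R := lt_of_le_of_ne (IsLocalRing.le_maximalIdeal hPp.ne_top)
      (fun h => hne h.ge)
    have hsp : Ideal.span (insert a (I : Set R)) = I ⊔ Ideal.span {a} := by
      rw [Ideal.span_insert, Ideal.span_eq, sup_comm]
    have := Ideal.mem_minimalPrimes_span_of_mem_minimalPrimes_span_insert hPm a (I : Set R)
      (by
        rw [hsp]
        refine ⟨⟨(maximalIdeal.isMaximal R).isPrime, hle⟩, ?_⟩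
        rintro Q ⟨hQ, hQ'⟩ -
        rw [← h]
        exact hQ.radical_le_iff.mpr hQ') (I : Set R)
      (fun y hy => hP (le_sup_left (a := I) hy))
      (fun y hy => by
        rw [hsp]
        exact Ideal.le_radical (le_sup_left (a := I) hy))
    rw [Ideal.span_eq] at this
    exact hav P this (hP (le_sup_right (a := I) (Ideal.mem_span_singleton_self w)))

lemma exists_avoid {I₁ I₂ : Ideal R} (h1 : I₁ ≤ maximalIdeal R) (h2 : I₂ ≤ maximalIdeal R)
    (h1' : I₁.radical ≠ maximalIdeal R) (h2' : I₂.radical ≠ maximalIdeal R) :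
    ∃ w ∈ maximalIdeal R, (∀ P ∈ I₁.minimalPrimes, w ∉ P) ∧ (∀ P ∈ I₂.minimalPrimes, w ∉ P) := by
  have aux : ∀ I : Ideal R, I ≤ maximalIdeal R → I.radical ≠ maximalIdeal R →
      ∀ P ∈ I.minimalPrimes, ¬ maximalIdeal R ≤ P := by
    intro I hI hI' P hP hle
    have hPm : P = maximalIdeal R :=
      le_antisymm (IsLocalRing.le_maximalIdeal hP.1.1.ne_top) hle
    subst hPm
    apply hI'
    apply le_antisymm
    · exact hP.1.1.radical_le_iff.mpr hI
    · rw [Ideal.radical_eq_sInf]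
      refine le_sInf ?_
      rintro Q ⟨hQ, hQp⟩
      exact hP.2 ⟨hQp, hQ⟩ (IsLocalRing.le_maximalIdeal hQp.ne_top)
  by_contra hcon
  push Not at hcon
  have hfin : (I₁.minimalPrimes ∪ I₂.minimalPrimes).Finite :=
    (Ideal.finite_minimalPrimes_of_isNoetherianRing R I₁).union
      (Ideal.finite_minimalPrimes_of_isNoetherianRing R I₂)
  have hsub : (maximalIdeal R : Set R) ⊆
      ⋃ P ∈ (I₁.minimalPrimes ∪ I₂.minimalPrimes), (P : Set R) := by
    intro w hw
    by_cases hq : ∀ P ∈ I₁.minimalPrimes, w ∉ P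
    · obtain ⟨P, hP, hwP⟩ := hcon w hw hq
      exact Set.mem_biUnion (Or.inr hP) hwP
    · push Not at hq
      obtain ⟨P, hP, hwP⟩ := hq
      exact Set.mem_biUnion (Or.inl hP) hwP
  rw [Ideal.subset_union_prime_finite (f := fun P => P) hfin ⊥ ⊥ (by
    rintro P (hP | hP) - - <;> exact hP.1.1)] at hsub
  obtain ⟨P, hP | hP, hle⟩ := hsub
  · exact aux I₁ h1 h1' P hP hle
  · exact aux I₂ h2 h2' P hP hle

theorem exchange (k : ℕ) : ∀ (N : Type*) [AddCommGroup N] [Module R N] (J : Ideal R)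
    (_ : ∀ j ∈ J, ∀ n : N, j • n = 0)
    (_ : ∀ l : List R, l.length < k → (J ⊔ Ideal.ofList l).radical ≠ maximalIdeal R)
    (_ : ∀ a ∈ maximalIdeal R, DC a N)
    (x y : List R) (_ : x.length = k) (_ : y.length = k)
    (_ : (J ⊔ Ideal.ofList x).radical = maximalIdeal R)
    (_ : (J ⊔ Ideal.ofList y).radical = maximalIdeal R)
    (_ : IsWeaklyRegular N x), IsWeaklyRegular N y := by
  induction k with
  | zero =>
    intro N _ _ J _ _ _ x y _ hy _ _ _
    rw [List.length_eq_zero_iff] at hy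
    subst hy
    exact IsWeaklyRegular.nil R N
  | succ k ih =>
    intro N _ _ J hJ hlen hdc x y hx hy hxr hyr hreg
    have split : ∀ l : List R, l.length = k + 1 → ∃ L b, l = L ++ [b] := by
      intro l hl
      rcases l.eq_nil_or_concat' with rfl | h
      · simp at hl
      · exact h
    obtain ⟨x', a, rfl⟩ := split x hx
    obtain ⟨y', b, rfl⟩ := split y hy
    simp only [List.length_append, List.length_singleton, Nat.add_right_cancel_iff] at hx hy
    rw [Ideal.ofList_append, Ideal.ofList_singleton, ← sup_assoc] at hxr hyr
    have hle1 : J ⊔ Ideal.ofList x' ≤ maximalIdeal R :=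
      le_sup_left.trans (Ideal.le_radical.trans hxr.le)
    have hle2 : J ⊔ Ideal.ofList y' ≤ maximalIdeal R :=
      le_sup_left.trans (Ideal.le_radical.trans hyr.le)
    obtain ⟨w, hwm, hw1, hw2⟩ := exists_avoid hle1 hle2
      (hlen x' (by omega)) (hlen y' (by omega))
    have hxw := radical_eq_of_avoid hxr hwm hw1
    have hyw := radical_eq_of_avoid hyr hwm hw2
    have memm : ∀ l : List R, J ⊔ Ideal.ofList l ≤ maximalIdeal R → ∀ r ∈ l,
        r ∈ maximalIdeal R := fun l hl r hr =>
      hl (le_sup_right (a := J) (Ideal.subset_span hr))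
    have ham : a ∈ maximalIdeal R := hxr ▸ Ideal.le_radical
      (le_sup_right (a := J ⊔ Ideal.ofList x') (Ideal.mem_span_singleton_self a))
    have h1 : IsWeaklyRegular N (x' ++ [w]) :=
      replace_last hJ hreg (by rw [hxw]; exact ham)
    have h2 : IsWeaklyRegular N (w :: x') := by
      refine perm_of_DC (List.perm_append_singleton w x') h1 ?_
      intro r hr
      rcases List.mem_append.mp hr with hr | hr
      · exact hdc r (memm x' hle1 r hr)
      · rw [List.mem_singleton.mp hr]; exact hdc w hwm
    rw [isWeaklyRegular_cons_iff] at h2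
    have h3 : IsWeaklyRegular (QuotSMulTop w N) y' := by
      refine ih (QuotSMulTop w N) (J ⊔ Ideal.span {w}) ?_ ?_ ?_ x' y' hx hy ?_ ?_ h2.2
      · intro j hj n
        obtain ⟨n, rfl⟩ := Submodule.mkQ_surjective _ n
        obtain ⟨j', hj', cw, hcw, rfl⟩ := Submodule.mem_sup.mp hj
        obtain ⟨c, rfl⟩ := Ideal.mem_span_singleton'.mp hcw
        rw [← map_smul, add_smul, hJ j' hj', zero_add, Submodule.mkQ_apply,
          Submodule.Quotient.mk_eq_zero, mul_comm, mul_smul]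
        exact ⟨c • n, trivial, rfl⟩
      · intro l hl
        have := hlen (w :: l) (by simpa using hl)
        rwa [Ideal.ofList_cons, ← sup_assoc] at this
      · intro r hr
        exact (hdc r hr).quotSMulTop w
      · rw [sup_right_comm]; exact hxw
      · rw [sup_right_comm]; exact hyw
    have h4 : IsWeaklyRegular N (w :: y') := IsWeaklyRegular.cons h2.1 h3
    have h5 : IsWeaklyRegular N (y' ++ [w]) := by
      refine perm_of_DC (List.perm_append_singleton w y').symm h4 ?_
      intro r hr
      rcases List.mem_cons.mp hr with rfl | hr
      · exact hdc r hwm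
      · exact hdc r (memm y' hle2 r hr)
    exact replace_last hJ h5 (by rw [hyr]; exact hwm)

end main

section powers
variable {R : Type*} [CommRing R]

lemma qmk_eq_zero {M : Type*} [AddCommGroup M] [Module R M] {r : R} {m : M} :
    (Submodule.mkQ (r • ⊤ : Submodule R M) m = 0) ↔ ∃ t : M, r • t = m := by
  rw [Submodule.mkQ_apply, Submodule.Quotient.mk_eq_zero]
  constructor
  · rintro ⟨t, -, ht⟩
    exact ⟨t, ht⟩
  · rintro ⟨t, ht⟩
    exact ⟨t, trivial, ht⟩

lemma wr_ext (rs : List R) : ∀ {A B C : Type*} [AddCommGroup A] [Module R A] [AddCommGroup B]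
    [Module R B] [AddCommGroup C] [Module R C] (f : A →ₗ[R] B) (g : B →ₗ[R] C)
    (_ : Function.Injective f) (_ : Function.Exact f g) (_ : Function.Surjective g)
    (_ : IsWeaklyRegular A rs) (_ : IsWeaklyRegular C rs), IsWeaklyRegular B rs := by
  induction rs with
  | nil => intros; exact IsWeaklyRegular.nil R _
  | cons r rs ih =>
    intro A B C _ _ _ _ _ _ f g hf hfg hg hA hC
    rw [isWeaklyRegular_cons_iff] at hA hC ⊢
    refine ⟨?_, ih (QuotSMulTop.map r f) (QuotSMulTop.map r g) ?_
      (QuotSMulTop.map_exact r hfg hg) (QuotSMulTop.map_surjective r hg) hA.2 hC.2⟩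
    · rw [isSMulRegular_iff_right_eq_zero_of_smul]
      intro b hb
      have h1 : g b = 0 := (isSMulRegular_iff_right_eq_zero_of_smul.mp hC.1) _
        (by rw [← map_smul, hb, map_zero])
      obtain ⟨a, rfl⟩ := (hfg b).mp h1
      have h2 : a = 0 := (isSMulRegular_iff_right_eq_zero_of_smul.mp hA.1) _
        (hf (by rw [map_smul, hb, map_zero]))
      rw [h2, map_zero]
    · rw [injective_iff_map_eq_zero]
      intro q hq
      obtain ⟨a, rfl⟩ := Submodule.mkQ_surjective _ q
      have hq' : Submodule.mkQ (r • ⊤ : Submodule R B) (f a) = 0 := hq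
      rw [qmk_eq_zero] at hq' ⊢
      obtain ⟨t, ht⟩ := hq'
      have h1 : g t = 0 := (isSMulRegular_iff_right_eq_zero_of_smul.mp hC.1) _
        (by rw [← map_smul, ht]; exact (hfg _).mpr ⟨a, rfl⟩)
      obtain ⟨a', rfl⟩ := (hfg t).mp h1
      exact ⟨a', hf (by rw [map_smul, ht])⟩

lemma wr_quot_pow {D : Type*} [AddCommGroup D] [Module R D] {s : R} {ts : List R}
    (hs : IsSMulRegular D s) (h : IsWeaklyRegular (QuotSMulTop s D) ts) (n : ℕ) :
    IsWeaklyRegular (QuotSMulTop (s ^ n) D) ts := by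
  induction n with
  | zero =>
    have : Subsingleton (QuotSMulTop (s ^ 0) D) := by
      rw [pow_zero]
      refine subsingleton_of_forall_eq 0 fun q => ?_
      obtain ⟨d, rfl⟩ := Submodule.mkQ_surjective _ q
      exact qmk_eq_zero.mpr ⟨d, one_smul _ d⟩
    refine ⟨fun i hi => ?_⟩
    have := (Submodule.mkQ_surjective
      (Ideal.ofList (ts.take i) • ⊤ : Submodule R (QuotSMulTop (s ^ 0) D))).subsingleton
    exact Function.injective_of_subsingleton _
  | succ n ih =>
    let f : QuotSMulTop (s ^ n) D →ₗ[R] QuotSMulTop (s ^ (n + 1)) D :=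
      Submodule.mapQ _ _ (LinearMap.lsmul R D s) (by
        rintro _ ⟨t, -, rfl⟩
        exact ⟨t, trivial, by simp [pow_succ, mul_smul]⟩)
    let g : QuotSMulTop (s ^ (n + 1)) D →ₗ[R] QuotSMulTop s D :=
      Submodule.mapQ _ _ LinearMap.id (by
        rintro _ ⟨t, -, rfl⟩
        exact ⟨s ^ n • t, trivial, by simp [pow_succ, mul_smul]⟩)
    have hfm : ∀ d, f (Submodule.mkQ _ d) = Submodule.mkQ _ (s • d) := fun d => rfl
    have hgm : ∀ d, g (Submodule.mkQ _ d) = Submodule.mkQ _ d := fun d => rfl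
    refine wr_ext ts f g ?_ ?_ ?_ ih h
    · rw [injective_iff_map_eq_zero]
      intro q hq
      obtain ⟨a, rfl⟩ := Submodule.mkQ_surjective _ q
      rw [hfm, qmk_eq_zero] at hq
      obtain ⟨t, ht⟩ := hq
      exact qmk_eq_zero.mpr ⟨t, hs (by
        simp only
        rw [← ht, pow_succ', mul_smul])⟩
    · intro q
      obtain ⟨a, rfl⟩ := Submodule.mkQ_surjective _ q
      rw [hgm, qmk_eq_zero]
      constructor
      · rintro ⟨t, rfl⟩
        exact ⟨Submodule.mkQ _ t, hfm t⟩
      · rintro ⟨p, hp⟩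
        obtain ⟨t, rfl⟩ := Submodule.mkQ_surjective _ p
        rw [hfm, ← sub_eq_zero, ← map_sub, qmk_eq_zero] at hp
        obtain ⟨u, hu⟩ := hp
        refine ⟨t - s ^ n • u, ?_⟩
        rw [smul_sub, smul_smul, ← pow_succ', hu]
        abel
    · intro q
      obtain ⟨a, rfl⟩ := Submodule.mkQ_surjective _ q
      exact ⟨Submodule.mkQ _ a, hgm a⟩

lemma wr_pow (n : ℕ) (ss : List R) : ∀ {D : Type*} [AddCommGroup D] [Module R D]
    (_ : IsWeaklyRegular D ss), IsWeaklyRegular D (ss.map (· ^ n)) := by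
  induction ss with
  | nil => intros; exact IsWeaklyRegular.nil R _
  | cons s ss ih =>
    intro D _ _ h
    rw [isWeaklyRegular_cons_iff] at h
    rw [List.map_cons, isWeaklyRegular_cons_iff]
    exact ⟨h.1.pow n, ih (wr_quot_pow h.1 h.2 n)⟩

lemma head_regular {r : R} (ss : List R) : ∀ {C : Type*} [AddCommGroup C] [Module R C]
    (_ : IsWeaklyRegular C (r :: ss)),
    IsSMulRegular (C ⧸ (Ideal.ofList ss • ⊤ : Submodule R C)) r := by
  induction ss with
  | nil =>
    intro C _ _ h
    rw [isWeaklyRegular_cons_iff] at h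
    exact ((Submodule.quotEquivOfEqBot (Ideal.ofList [] • ⊤ : Submodule R C)
      (by simp)).isSMulRegular_congr r).mpr h.1
  | cons s ss ih =>
    intro C _ _ h
    have h' := (isWeaklyRegular_append_iff C [r, s] ss).mp h
    rw [((Submodule.quotOfListConsSMulTopEquivQuotSMulTopInner C s ss).isSMulRegular_congr r)]
    apply ih
    have hl : (Ideal.ofList [r, s] : Ideal R) = Ideal.ofList [s, r] := by
      simp [Ideal.ofList_cons, sup_comm]
    rw [hl] at h'
    refine (isWeaklyRegular_append_iff (QuotSMulTop s C) [r] ss).mpr ⟨?_, ?_⟩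
    · rw [isWeaklyRegular_singleton_iff]
      have h1 := h'.1
      rw [isWeaklyRegular_cons_iff, isWeaklyRegular_singleton_iff] at h1
      rw [isSMulRegular_iff_right_eq_zero_of_smul]
      intro q hq
      obtain ⟨b, rfl⟩ := Submodule.mkQ_surjective _ q
      rw [← map_smul, qmk_eq_zero] at hq
      obtain ⟨c, hc⟩ := hq
      have h2 : Submodule.mkQ (r • ⊤ : Submodule R C) c = 0 :=
        (isSMulRegular_iff_right_eq_zero_of_smul.mp h1.2) _
          (by rw [← map_smul, qmk_eq_zero]; exact ⟨b, hc.symm⟩)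
      obtain ⟨d, rfl⟩ := qmk_eq_zero.mp h2
      refine qmk_eq_zero.mpr ⟨d, h1.1 ?_⟩
      simp only
      rw [← hc, smul_comm]
    · exact ((Submodule.quotOfListConsSMulTopEquivQuotSMulTopInner C s [r]).isWeaklyRegular_congr
        ss).mp h'.2

lemma ofList_pow_le (rs : List R) (n : ℕ) (I : Ideal R) (h : ∀ r ∈ rs, r ∈ I) :
    Ideal.ofList (rs.map (· ^ n)) ≤ I ^ n := by
  rw [Ideal.ofList, Ideal.span_le]
  intro x hx
  obtain ⟨r, hr, rfl⟩ := List.mem_map.mp hx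
  exact Ideal.pow_mem_pow (h r hr) n

lemma exists_pow_ofList_le (rs : List R) (n : ℕ) :
    ∃ m, Ideal.ofList rs ^ m ≤ Ideal.ofList (rs.map (· ^ n)) := by
  classical
  refine Ideal.exists_pow_le_of_le_radical_of_fg ?_ ⟨rs.toFinset, by
    simp [Ideal.ofList]⟩
  rw [Ideal.ofList, Ideal.span_le]
  intro r hr
  exact ⟨n, Ideal.subset_span (List.mem_map.mpr ⟨r, hr, rfl⟩)⟩

lemma star_pow {C : Type*} [AddCommGroup C] [Module R C] {r : R} {ss : List R}
    (h : IsWeaklyRegular C (r :: ss)) (n : ℕ) (c : C)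
    (hc : r • c ∈ (Ideal.ofList ((r :: ss).map (· ^ (n + 1))) • ⊤ : Submodule R C)) :
    c ∈ (Ideal.ofList ((r :: ss).map (· ^ n)) • ⊤ : Submodule R C) := by
  have h1 : IsWeaklyRegular C (r :: ss.map (· ^ (n + 1))) := by
    rw [isWeaklyRegular_cons_iff] at h ⊢
    exact ⟨h.1, wr_pow _ _ h.2⟩
  have h2 := head_regular _ h1
  rw [List.map_cons, Ideal.ofList_cons, Submodule.sup_smul] at hc ⊢
  obtain ⟨p, hp, u, hu, hpu⟩ := Submodule.mem_sup.mp hc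
  rw [Submodule.ideal_span_singleton_smul] at hp
  obtain ⟨e, -, rfl⟩ := hp
  have h3 : Submodule.mkQ (Ideal.ofList (ss.map (· ^ (n + 1))) • ⊤ : Submodule R C)
      (c - r ^ n • e) = 0 := by
    apply (isSMulRegular_iff_right_eq_zero_of_smul.mp h2)
    rw [← map_smul, Submodule.mkQ_apply, Submodule.Quotient.mk_eq_zero]
    have : r • (c - r ^ n • e) = u := by
      rw [smul_sub, ← hpu, smul_smul, ← pow_succ']
      simp
    rwa [this]
  rw [Submodule.mkQ_apply, Submodule.Quotient.mk_eq_zero] at h3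
  have h4 : c = r ^ n • e + (c - r ^ n • e) := by abel
  rw [h4]
  refine Submodule.add_mem_sup ?_ ?_
  · exact Submodule.smul_mem_smul (Ideal.mem_span_singleton_self _) trivial
  · refine Submodule.smul_mono_left ?_ h3
    rw [Ideal.ofList, Ideal.span_le]
    intro x hx
    obtain ⟨s, hs, rfl⟩ := List.mem_map.mp hx
    rw [pow_succ]
    exact Ideal.mul_mem_right _ _ (Ideal.subset_span (List.mem_map.mpr ⟨s, hs, rfl⟩))

lemma star {C : Type*} [AddCommGroup C] [Module R C] {r : R} {ss : List R} (I : Ideal R)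
    (h : IsWeaklyRegular C (r :: ss)) (hI : ∀ s ∈ r :: ss, s ∈ I) 
    (hk : ∃ k, (I ^ k • ⊤ : Submodule R C) ≤ Ideal.ofList (r :: ss) • ⊤) (n : ℕ) :
    ∃ N, ∀ c : C, r • c ∈ (I ^ N • ⊤ : Submodule R C) → c ∈ (I ^ n • ⊤ : Submodule R C) := by
  obtain ⟨k, hk⟩ := hk
  obtain ⟨m, hm⟩ := exists_pow_ofList_le (r :: ss) (n + 1)
  have hpow : ∀ m, (I ^ (k * m) • ⊤ : Submodule R C) ≤ Ideal.ofList (r :: ss) ^ m • ⊤ := by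
    intro m
    induction m with
    | zero => simp
    | succ m ih =>
      calc (I ^ (k * (m + 1)) • ⊤ : Submodule R C) = I ^ k • (I ^ (k * m) • ⊤) := by
            rw [← Submodule.mul_smul, ← pow_add]; congr 2; ring
        _ ≤ I ^ k • (Ideal.ofList (r :: ss) ^ m • ⊤) := Submodule.smul_mono le_rfl ih
        _ = Ideal.ofList (r :: ss) ^ m • (I ^ k • ⊤) := by
            rw [← Submodule.mul_smul, mul_comm, Submodule.mul_smul]
        _ ≤ Ideal.ofList (r :: ss) ^ m • (Ideal.ofList (r :: ss) • ⊤) :=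
            Submodule.smul_mono le_rfl hk
        _ = _ := by rw [← Submodule.mul_smul, ← pow_succ]
  refine ⟨k * m, fun c hc => ?_⟩
  exact Submodule.smul_mono_left (ofList_pow_le _ n I hI)
    (star_pow h n c (Submodule.smul_mono_left hm (hpow m hc)))

end powers

section completion
variable {R : Type*} [CommRing R] (I : Ideal R) {C : Type*} [AddCommGroup C] [Module R C] {r : R}

lemma compl_regular
    (hst : ∀ n, ∃ N, ∀ c : C, r • c ∈ (I ^ N • ⊤ : Submodule R C) → c ∈ (I ^ n • ⊤ : Submodule R C)) :
    IsSMulRegular (AdicCompletion I C) r := by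
  rw [isSMulRegular_iff_right_eq_zero_of_smul]
  intro z
  induction z using AdicCompletion.induction_on with
  | _ c =>
  intro hz
  ext n
  obtain ⟨N, hN⟩ := hst n
  have h1 : r • c (N + n) ∈ (I ^ (N + n) • ⊤ : Submodule R C) := by
    have := congrArg (fun z => z.val (N + n)) hz
    simp only [AdicCompletion.val_smul_apply, AdicCompletion.mk_apply_coe,
      AdicCompletion.val_zero_apply] at this
    rw [← map_smul, Submodule.mkQ_apply, Submodule.Quotient.mk_eq_zero] at this
    exact this
  have h2 := hN _ (Submodule.smul_mono_left (Ideal.pow_le_pow_right (by omega)) h1)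
  have h3 := c.2 (show n ≤ N + n by omega)
  rw [AdicCompletion.mk_apply_coe, AdicCompletion.val_zero_apply, Submodule.mkQ_apply]
  refine (SModEq.def.mp h3).trans ?_
  exact (Submodule.Quotient.mk_eq_zero _).mpr h2

lemma compl_ker
    (hst : ∀ n, ∃ N, ∀ c : C, r • c ∈ (I ^ N • ⊤ : Submodule R C) → c ∈ (I ^ n • ⊤ : Submodule R C)) :
    LinearMap.ker ((AdicCompletion.map I (Submodule.mkQ (r • ⊤ : Submodule R C))).restrictScalars R)
      = r • ⊤ := by
  apply le_antisymm
  · intro z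
    induction z using AdicCompletion.induction_on with
    | _ c =>
    intro hz
    choose N hN using hst
    let K : ℕ → ℕ := fun n => (∑ i ∈ Finset.range (n + 1), N i) + n
    have hK1 : ∀ n, N n ≤ K n := fun n =>
      (Finset.single_le_sum (f := N) (fun _ _ => Nat.zero_le _)
        (Finset.self_mem_range_succ n)).trans (Nat.le_add_right _ _)
    have hK2 : ∀ n, n ≤ K n := fun n => Nat.le_add_left _ _
    have hK3 : ∀ n, K n ≤ K (n + 1) := fun n => by
      simp only [K]
      rw [Finset.sum_range_succ _ (n + 1)]
      omega
    have hex : ∀ n, ∃ e : C, c n - r • e ∈ (I ^ n • ⊤ : Submodule R C) := by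
      intro n
      have h1 : (AdicCompletion.map I (Submodule.mkQ (r • ⊤ : Submodule R C))
        (AdicCompletion.mk I C c)).val n = 0 := by
        have : AdicCompletion.map I (Submodule.mkQ (r • ⊤ : Submodule R C))
          (AdicCompletion.mk I C c) = 0 := hz
        rw [this]; rfl
      rw [AdicCompletion.map_mk, AdicCompletion.mk_apply_coe, Submodule.mkQ_apply,
        Submodule.Quotient.mk_eq_zero] at h1
      have h2 : (I ^ n • ⊤ : Submodule R (C ⧸ (r • ⊤ : Submodule R C))) =
          Submodule.map (Submodule.mkQ (r • ⊤ : Submodule R C)) (I ^ n • ⊤) := by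
        rw [Submodule.map_smul'', Submodule.map_top, Submodule.range_mkQ]
      rw [h2] at h1
      obtain ⟨u, hu, hu'⟩ := h1
      have h3 : Submodule.mkQ (r • ⊤ : Submodule R C) (c n - u) = 0 := by
        rw [map_sub, hu', sub_eq_zero]; rfl
      obtain ⟨e, he⟩ := qmk_eq_zero.mp h3
      exact ⟨e, by rw [he]; simpa using hu⟩
    choose e he using hex
    have hcc : ∀ {m n}, m ≤ n → c m - c n ∈ (I ^ m • ⊤ : Submodule R C) := fun {m n} h =>
      (SModEq.sub_mem.mp (c.2 h))
    have hle : ∀ {m n}, m ≤ n → (I ^ n • ⊤ : Submodule R C) ≤ I ^ m • ⊤ := fun h =>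
      Submodule.smul_mono_left (Ideal.pow_le_pow_right h)
    let E : AdicCompletion.AdicCauchySequence I C :=
      AdicCompletion.AdicCauchySequence.mk I C (fun n => e (K n)) (by
        intro n
        rw [SModEq.sub_mem]
        apply hN n
        apply hle (hK1 n)
        have : r • (e (K n) - e (K (n + 1))) =
            (c (K n) - c (K (n + 1))) - (c (K n) - r • e (K n))
              + (c (K (n + 1)) - r • e (K (n + 1))) := by
          rw [smul_sub]; abel
        rw [this]
        exact add_mem (sub_mem (hcc (hK3 n)) (he _)) (hle (hK3 n) (he _)))
    refine ⟨AdicCompletion.mk I C E, trivial, ?_⟩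
    change r • AdicCompletion.mk I C E = AdicCompletion.mk I C c
    ext n
    rw [AdicCompletion.val_smul_apply, AdicCompletion.mk_apply_coe, AdicCompletion.mk_apply_coe,
      ← map_smul, ← sub_eq_zero, ← map_sub, Submodule.mkQ_apply, Submodule.Quotient.mk_eq_zero]
    change r • e (K n) - c n ∈ _
    have : r • e (K n) - c n = -(c (K n) - r • e (K n)) - (c n - c (K n)) := by abel
    rw [this]
    exact sub_mem (neg_mem (hle (hK2 n) (he _))) (hcc (hK2 n))
  · rintro _ ⟨z, -, rfl⟩
    rw [LinearMap.mem_ker]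
    change (AdicCompletion.map I (Submodule.mkQ (r • ⊤ : Submodule R C))).restrictScalars R
      (r • z) = 0
    rw [map_smul]
    induction z using AdicCompletion.induction_on with
    | _ c =>
    ext n
    rw [AdicCompletion.val_smul_apply, LinearMap.restrictScalars_apply, AdicCompletion.map_mk,
      AdicCompletion.mk_apply_coe, ← map_smul, AdicCompletion.val_zero_apply]
    have : r • (AdicCompletion.AdicCauchySequence.map I
      (Submodule.mkQ (r • ⊤ : Submodule R C)) c) n = 0 := by
      change r • Submodule.mkQ (r • ⊤ : Submodule R C) (c n) = 0
      rw [← map_smul]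
      exact qmk_eq_zero.mpr ⟨c n, rfl⟩
    rw [this, map_zero]

theorem compl_wr (rs : List R) (hI : ∀ s ∈ rs, s ∈ I) :
    ∀ {C : Type*} [AddCommGroup C] [Module R C]
    (_ : ∃ k, (I ^ k • ⊤ : Submodule R C) ≤ Ideal.ofList rs • ⊤)
    (_ : IsWeaklyRegular C rs), IsWeaklyRegular (AdicCompletion I C) rs := by
  induction rs with
  | nil => intros; exact IsWeaklyRegular.nil R _
  | cons r ss ih =>
    intro C _ _ hk h
    have hst := star I h hI hk
    refine IsWeaklyRegular.cons (compl_regular I hst) ?_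
    have e : QuotSMulTop r (AdicCompletion I C) ≃ₗ[R] AdicCompletion I (QuotSMulTop r C) :=
      (Submodule.quotEquivOfEq _ _ (compl_ker I hst).symm).trans
        (LinearMap.quotKerEquivOfSurjective _
          (AdicCompletion.map_surjective I (Submodule.mkQ_surjective (r • ⊤ : Submodule R C))))
    rw [e.isWeaklyRegular_congr]
    rw [isWeaklyRegular_cons_iff] at h
    refine ih (fun s hs => hI s (List.mem_cons_of_mem _ hs)) ?_ h.2
    obtain ⟨k, hk⟩ := hk
    refine ⟨k, ?_⟩
    have h2 : ∀ L : Ideal R, (L • ⊤ : Submodule R (QuotSMulTop r C)) =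
          Submodule.map (Submodule.mkQ (r • ⊤ : Submodule R C)) (L • ⊤) := by
      intro L
      rw [Submodule.map_smul'', Submodule.map_top, Submodule.range_mkQ]
    rw [h2, h2]
    refine (Submodule.map_mono hk).trans ?_
    rw [Ideal.ofList_cons, Submodule.sup_smul, Submodule.map_sup]
    refine sup_le ?_ le_rfl
    rintro _ ⟨u, hu, rfl⟩
    rw [SetLike.mem_coe, Submodule.ideal_span_singleton_smul] at hu
    obtain ⟨t, -, rfl⟩ := hu
    have : Submodule.mkQ (r • ⊤ : Submodule R C) (r • t) = 0 := qmk_eq_zero.mpr ⟨t, rfl⟩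
    change Submodule.mkQ (r • ⊤ : Submodule R C) (r • t) ∈ _
    rw [this]
    exact zero_mem _

end completion

section dccomplete

lemma DC.of_adicComplete {S : Type*} [CommRing S] {I : Ideal S} {M : Type*} [AddCommGroup M]
    [Module S M] [IsAdicComplete I M] {a : S} (ha : a ∈ I) : DC a M := by
  have hmem : ∀ (k : ℕ) (m : M), a ^ k • m ∈ (I ^ k • ⊤ : Submodule S M) := fun k m =>
    Submodule.smul_mem_smul (Ideal.pow_mem_pow ha k) trivial
  refine DC.of_inj (fun t => ?_) (fun m hm => ?_)
  · have hlim : ∀ n, ∃ L : M, ∀ k, (∑ j ∈ Finset.range k, a ^ j • t (n + j)) ≡ L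
        [SMOD (I ^ k • ⊤ : Submodule S M)] := by
      intro n
      refine IsPrecomplete.prec inferInstance ?_
      intro p q hpq
      obtain ⟨d, rfl⟩ := Nat.exists_eq_add_of_le hpq
      rw [SModEq.sub_mem, Finset.sum_range_add, sub_add_cancel_left]
      refine neg_mem (sum_mem fun j _ => ?_)
      rw [pow_add, mul_smul]
      exact hmem p _
    choose L hL using hlim
    refine ⟨L, ?_⟩
    funext n
    rw [← sub_eq_zero]
    refine IsHausdorff.haus (I := I) inferInstance _ fun k => ?_
    rw [SModEq.zero]
    have h1 := SModEq.sub_mem.mp (hL n k)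
    have h2 := SModEq.sub_mem.mp (hL (n + 1) k)
    have h3 : (∑ j ∈ Finset.range k, a ^ j • t (n + j)) + a ^ k • t (n + k) =
        t n + a • ∑ j ∈ Finset.range k, a ^ j • t (n + 1 + j) := by
      rw [← Finset.sum_range_succ (fun j => a ^ j • t (n + j)), Finset.sum_range_succ',
        Finset.smul_sum, add_comm]
      congr 1
      · simp
      · refine Finset.sum_congr rfl fun j _ => ?_
        rw [smul_smul, ← pow_succ', show n + (j + 1) = n + 1 + j by ring]
    have h4 : L n - a • L (n + 1) - t n =
        -((∑ j ∈ Finset.range k, a ^ j • t (n + j)) - L n)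
        + a • ((∑ j ∈ Finset.range k, a ^ j • t (n + 1 + j)) - L (n + 1))
        - a ^ k • t (n + k) := by
      have h5 := eq_sub_of_add_eq h3
      rw [h5, smul_sub]
      abel
    rw [h4]
    exact sub_mem (add_mem (neg_mem h1) (Submodule.smul_mem _ _ h2)) (hmem k _)
  · funext n
    refine IsHausdorff.haus (I := I) inferInstance _ fun k => ?_
    rw [SModEq.zero]
    have : m n = a ^ k • m (n + k) := by
      induction k with
      | zero => simp
      | succ k ih => rw [ih, hm (n + k), smul_smul, ← pow_succ]; rfl
    rw [this]
    exact hmem k _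

end dccomplete

end BBCM

/-- If `B` is big Cohen-Macaulay with respect to one system of parameters of the
Noetherian local ring `R`, then the `m`-adic completion of `B` is a balanced big
Cohen-Macaulay `R`-algebra: every system of parameters of `R` is a regular sequence on
the completion of `B`. -/
theorem completion_balanced_bigCM (R : Type*) [CommRing R] [IsNoetherianRing R]
    [IsLocalRing R] (B : Type*) [CommRing B] [Algebra R B]
    (d : ℕ) (hd : ringKrullDim R = d)
    (x : Fin d → R) (hx1 : ∀ i, x i ∈ IsLocalRing.maximalIdeal R)
    (hx2 : (Ideal.span (Set.range x)).radical = IsLocalRing.maximalIdeal R)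
    (hreg : RingTheory.Sequence.IsRegular B (List.ofFn fun i => algebraMap R B (x i))) :
    ∀ y : Fin d → R, (∀ i, y i ∈ IsLocalRing.maximalIdeal R) →
      (Ideal.span (Set.range y)).radical = IsLocalRing.maximalIdeal R →
      RingTheory.Sequence.IsRegular
        (AdicCompletion ((IsLocalRing.maximalIdeal R).map (algebraMap R B)) B)
        (List.ofFn fun i =>
          algebraMap B (AdicCompletion ((IsLocalRing.maximalIdeal R).map (algebraMap R B)) B)
            (algebraMap R B (y i))) := by
  intro y hy1 hy2
  have spanx : ∀ z : Fin d → R, Ideal.ofList (List.ofFn z) = Ideal.span (Set.range z) := by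
    intro z
    rw [Ideal.ofList]
    congr 1
    ext r
    simp [List.mem_ofFn]
  have mapl : ∀ z : Fin d → R, (List.ofFn fun i => algebraMap R B (z i)) =
      (List.ofFn z).map (algebraMap R B) := by
    intro z
    rw [List.map_ofFn]; rfl
  set m := IsLocalRing.maximalIdeal R with hm
  set I : Ideal B := m.map (algebraMap R B) with hIdef
  have hIfg : I.FG := Ideal.FG.map (IsNoetherian.noetherian m) _
  -- some power of `I` is inside `xB`
  have hpow : ∃ k, I ^ k ≤ Ideal.ofList (List.ofFn fun i => algebraMap R B (x i)) := by
    obtain ⟨k, hk⟩ := Ideal.exists_pow_le_of_le_radical_of_fg hx2.ge (IsNoetherian.noetherian m)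
    refine ⟨k, ?_⟩
    rw [mapl, ← Ideal.map_ofList, spanx, hIdef, ← Ideal.map_pow]
    exact Ideal.map_mono hk
  have hIne : I ≠ ⊤ := by
    intro hI
    obtain ⟨k, hk⟩ := hpow
    apply hreg.top_ne_smul
    rw [hI, Ideal.top_pow, top_le_iff] at hk
    rw [hk, Submodule.top_smul]
  have hxI : ∀ s ∈ (List.ofFn fun i => algebraMap R B (x i)), s ∈ I := by
    intro s hs
    obtain ⟨i, rfl⟩ := List.mem_ofFn.mp hs
    exact Ideal.mem_map_of_mem _ (hx1 i)
  have hx_compl : RingTheory.Sequence.IsWeaklyRegular (AdicCompletion I B)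
      (List.ofFn fun i => algebraMap R B (x i)) := by
    refine BBCM.compl_wr I _ hxI ?_ hreg.toIsWeaklyRegular
    obtain ⟨k, hk⟩ := hpow
    exact ⟨k, Submodule.smul_mono_left hk⟩
  rw [mapl, RingTheory.Sequence.isWeaklyRegular_map_algebraMap_iff] at hx_compl
  have hac : IsAdicComplete I (AdicCompletion I B) := AdicCompletion.isAdicComplete hIfg
  have hdc : ∀ a ∈ m, BBCM.DC a (AdicCompletion I B) := by
    intro a ha
    have h := BBCM.DC.of_adicComplete (I := I) (M := AdicCompletion I B)
      (Ideal.mem_map_of_mem (algebraMap R B) ha)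
    unfold BBCM.DC at h ⊢
    simpa only [algebraMap_smul] using h
  have hlen : ∀ l : List R, l.length < d → (⊥ ⊔ Ideal.ofList l).radical ≠ m := by
    intro l hl hrad
    classical
    rw [bot_sup_eq] at hrad
    have hmin : m ∈ (Ideal.span (l.toFinset : Set R)).minimalPrimes := by
      have h0 : Ideal.span (l.toFinset : Set R) = Ideal.ofList l := by simp [Ideal.ofList]
      rw [h0]
      refine ⟨⟨(IsLocalRing.maximalIdeal.isMaximal R).isPrime, hrad ▸ Ideal.le_radical⟩, ?_⟩
      rintro Q ⟨hQ, hQ'⟩ -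
      rw [← hrad]
      exact hQ.radical_le_iff.mpr hQ'
    have h1 := Ideal.height_le_card_of_mem_minimalPrimes_span_finset hmin
    have h2 := IsLocalRing.maximalIdeal_height_eq_ringKrullDim (R := R)
    rw [hd, ← hm] at h2
    have h3 : m.height = (d : ℕ∞) := by exact_mod_cast h2
    rw [h3] at h1
    have h4 : d ≤ l.toFinset.card := by exact_mod_cast h1
    have := l.toFinset_card_le
    omega
  have hy_compl : RingTheory.Sequence.IsWeaklyRegular (AdicCompletion I B) (List.ofFn y) :=
    BBCM.exchange d (AdicCompletion I B) ⊥ (by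
      intro j hj n
      rw [Ideal.mem_bot.mp hj, zero_smul]) hlen hdc (List.ofFn x) (List.ofFn y) (by simp) (by simp)
      (by rw [bot_sup_eq, spanx, hx2]) (by rw [bot_sup_eq, spanx, hy2]) hx_compl
  have hlist : (List.ofFn fun i => algebraMap B (AdicCompletion I B) (algebraMap R B (y i))) =
      ((List.ofFn y).map (algebraMap R B)).map (algebraMap B (AdicCompletion I B)) := by
    rw [List.map_ofFn, List.map_ofFn]; rfl
  rw [hlist]
  refine ⟨?_, ?_⟩
  · rw [RingTheory.Sequence.isWeaklyRegular_map_algebraMap_iff,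
      RingTheory.Sequence.isWeaklyRegular_map_algebraMap_iff]
    exact hy_compl
  · intro htop
    rw [← Ideal.map_ofList, ← Ideal.map_ofList, spanx, smul_eq_mul, Ideal.mul_top] at htop
    have h1 : (⊤ : Ideal (AdicCompletion I B)) ≤
        RingHom.ker (AdicCompletion.evalOneₐ I).toRingHom := by
      rw [AdicCompletion.ker_evalOneₐ_eq_map I hIfg, htop]
      refine Ideal.map_mono (Ideal.map_mono ?_)
      rw [← hy2]
      exact Ideal.le_radical
    have h2 : (AdicCompletion.evalOneₐ I).toRingHom 1 = 0 := h1 trivial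
    rw [map_one] at h2
    have := Ideal.Quotient.nontrivial_iff.mpr hIne
    exact one_ne_zero h2
end

section
/- Let R → S be a pure local homomorphism of Noetherian local rings. Then the induced map of completions R^ → S^ (with respect to the maximal ideals) is pure. -/
universe u

/-- A ring homomorphism `f : A → B` is pure if `M → B ⊗_A M` is injective for every
`A`-module `M` (where `B` is regarded as an `A`-algebra via `f`). -/
def RingHom.IsPure {A B : Type u} [CommRing A] [CommRing B] (f : A →+* B) : Prop := by
  letI : Algebra A B := f.toAlgebra
  exact ∀ (M : Type u) [AddCommGroup M] [Module A M],
    Function.Injective (fun m : M => (1 : B) ⊗ₜ[A] m)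

set_option linter.style.haveILetI false

theorem adicCompletion_isNoetherianRing {R : Type u} [CommRing R] [IsNoetherianRing R]
    (I : Ideal R) : IsNoetherianRing (AdicCompletion I R) := by
  obtain ⟨s, hs⟩ := I.fg_of_isNoetherianRing
  let A := AdicCompletion I R
  let J : Ideal A := I.map (algebraMap R A)
  have hJ : IsAdicComplete J A := AdicCompletion.isAdicComplete_self I I.fg_of_isNoetherianRing
  letI : WithIdeal A := ⟨J⟩
  have hadic : IsAdic J := rfl
  have hc := hadic.isAdicComplete_iff.mp hJ
  have := hc.1
  have := hc.2
  letI : UniformSpace R := ⊥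
  haveI : DiscreteTopology R := ⟨rfl⟩
  haveI : IsUniformAddGroup R := inferInstance
  have hφ : Continuous (algebraMap R A) := continuous_of_discreteTopology
  let a : s → A := fun i => algebraMap R A i.1
  have haJ : ∀ i, a i ∈ J := fun i =>
    Ideal.mem_map_of_mem _ (hs ▸ Ideal.subset_span i.2)
  have ha : MvPowerSeries.HasEval a :=
    ⟨fun i => WithIdeal.isTopologicallyNilpotent_of_mem (haJ i), by
      rw [Filter.cofinite_eq_bot]; exact Filter.tendsto_bot⟩
  let φ : MvPowerSeries s R →+* A := MvPowerSeries.eval₂Hom hφ ha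
  have hφX : ∀ i, φ (MvPowerSeries.X i) = a i := fun i => by
    simp only [φ, MvPowerSeries.coe_eval₂Hom, MvPowerSeries.eval₂_X]
  have hφC : ∀ r, φ (MvPowerSeries.C r) = algebraMap R A r := fun i => by
    simp only [φ, MvPowerSeries.coe_eval₂Hom, MvPowerSeries.eval₂_C]
  have hmap : (Ideal.span (Set.range MvPowerSeries.X) : Ideal (MvPowerSeries s R)).map φ = J := by
    rw [Ideal.map_span]
    simp only [J, ← hs, Ideal.map_span]
    congr 1
    ext y
    constructor
    · rintro ⟨_, ⟨i, rfl⟩, rfl⟩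
      exact ⟨i.1, i.2, (hφX i).symm⟩
    · rintro ⟨i, hi, rfl⟩
      exact ⟨_, ⟨⟨i, hi⟩, rfl⟩, hφX _⟩
  have hsurj : Function.Surjective φ := by
    haveI : IsHausdorff ((Ideal.span (Set.range MvPowerSeries.X) :
      Ideal (MvPowerSeries s R)).map φ) A := by rw [hmap]; infer_instance
    refine surjective_of_mk_map_comp_surjective
      (I := (Ideal.span (Set.range MvPowerSeries.X) : Ideal (MvPowerSeries s R))) φ ?_
    intro y
    obtain ⟨y, rfl⟩ := Ideal.Quotient.mk_surjective y
    obtain ⟨r, hr⟩ := Ideal.Quotient.mk_surjective (AdicCompletion.evalOneₐ I y)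
    refine ⟨MvPowerSeries.C r, ?_⟩
    rw [RingHom.comp_apply, Ideal.Quotient.eq, hmap, hφC]
    change _ ∈ I.map (algebraMap R (AdicCompletion I R))
    rw [← AdicCompletion.ker_evalOneₐ_eq_map I I.fg_of_isNoetherianRing, RingHom.mem_ker, map_sub,
      sub_eq_zero]
    exact hr
  exact isNoetherianRing_of_surjective _ _ φ hsurj

section
open IsLocalRing TensorProduct

theorem exists_sub_mem_pow {R : Type u} [CommRing R] (I : Ideal R) (hI : I.FG) (n : ℕ)
    (a : AdicCompletion I R) :
    ∃ r : R, a - algebraMap R (AdicCompletion I R) r ∈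
      (I.map (algebraMap R (AdicCompletion I R))) ^ n := by
  obtain ⟨r, hr⟩ := Submodule.mkQ_surjective _ (AdicCompletion.eval I R n a)
  refine ⟨r, ?_⟩
  rw [← Ideal.map_pow, ← Submodule.restrictScalars_mem R, ← Ideal.smul_top_eq_map,
    AdicCompletion.pow_smul_top_eq_ker_eval hI, LinearMap.mem_ker, map_sub, ← hr, sub_eq_zero]
  rfl

theorem pure_key {R S : Type u} [CommRing R] [CommRing S]
    [IsNoetherianRing R] [IsNoetherianRing S] [IsLocalRing R] [IsLocalRing S]
    [Algebra R S] (hloc : IsLocalHom (algebraMap R S))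
    [Algebra (AdicCompletion (maximalIdeal R) R) (AdicCompletion (maximalIdeal S) S)]
    (hF : ∀ r : R, algebraMap (AdicCompletion (maximalIdeal R) R)
        (AdicCompletion (maximalIdeal S) S) (algebraMap R _ r) = algebraMap S _ (algebraMap R S r))
    (P : Type u) [AddCommGroup P] [Module R P] [Module (AdicCompletion (maximalIdeal R) R) P]
    [IsScalarTower R (AdicCompletion (maximalIdeal R) R) P]
    [Module.Finite (AdicCompletion (maximalIdeal R) R) P]
    (hf : Function.Injective (fun p : P => (1 : S) ⊗ₜ[R] p))
    (k : ℕ) (hk : ∀ a ∈ ((maximalIdeal R).map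
      (algebraMap R (AdicCompletion (maximalIdeal R) R))) ^ k, ∀ p : P, a • p = 0)
    (x : P) (hx : (1 : AdicCompletion (maximalIdeal S) S) ⊗ₜ[AdicCompletion (maximalIdeal R) R] x
      = 0) : x = 0 := by
  set A := AdicCompletion (maximalIdeal R) R with hA
  set B := AdicCompletion (maximalIdeal S) S with hB
  have hfg : (maximalIdeal R).FG := Ideal.fg_of_isNoetherianRing _
  -- `P` is finite over `R`
  haveI : Module.Finite R P := by
    obtain ⟨s, hs⟩ := (Module.Finite.fg_top : (⊤ : Submodule A P).FG)
    refine ⟨⟨s, ?_⟩⟩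
    rw [eq_top_iff]
    rintro p -
    have hp : p ∈ Submodule.span A (s : Set P) := hs ▸ Submodule.mem_top
    induction hp using Submodule.span_induction with
    | mem y hy => exact Submodule.subset_span hy
    | zero => exact zero_mem _
    | add y z _ _ hy hz => exact add_mem hy hz
    | smul a y _ hy =>
      obtain ⟨r, hr⟩ := exists_sub_mem_pow _ hfg k a
      have h1 := hk _ hr y
      rw [sub_smul, sub_eq_zero, algebraMap_smul] at h1
      rw [h1]
      exact Submodule.smul_mem _ _ hy
  -- suffices: vanishing in `S ⊗ P`, by Krull modulo `n ^ j`
  apply hf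
  simp only [TensorProduct.tmul_zero]
  refine IsHausdorff.haus (inferInstance : IsHausdorff (maximalIdeal S) (S ⊗[R] P)) _ fun j => ?_
  let N : Submodule S (S ⊗[R] P) := (maximalIdeal S) ^ j • ⊤
  let Q := (S ⊗[R] P) ⧸ N
  let ev : B →ₐ[S] S ⧸ (maximalIdeal S) ^ j := AdicCompletion.evalₐ (maximalIdeal S) j
  have hevF : ∀ c ∈ ((maximalIdeal R).map (algebraMap R A)) ^ (max j k),
      ev (algebraMap A B c) = 0 := by
    intro c hc
    rw [← Ideal.map_pow] at hc
    have hle : ((maximalIdeal R) ^ (max j k)).map (algebraMap R A) ≤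
        RingHom.ker ((ev : B →+* S ⧸ (maximalIdeal S) ^ j).comp (algebraMap A B)) := by
      rw [Ideal.map_le_iff_le_comap]
      intro r hr
      rw [Ideal.mem_comap, RingHom.mem_ker, RingHom.comp_apply, hF]
      have h2 : algebraMap R S r ∈ (maximalIdeal S) ^ (max j k) := by
        have h3 : (maximalIdeal R).map (algebraMap R S) ≤ maximalIdeal S :=
          ((IsLocalRing.local_hom_TFAE (algebraMap R S)).out 0 2).mp hloc
        have h4 := Ideal.pow_right_mono h3 (max j k)
        rw [← Ideal.map_pow] at h4
        exact h4 (Ideal.mem_map_of_mem _ hr)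
      have h5 := ev.commutes (algebraMap R S r)
      refine h5.trans ?_
      exact Ideal.Quotient.eq_zero_iff_mem.mpr (Ideal.pow_le_pow_right (le_max_left j k) h2)
    exact hle hc
  let β : P →+ Q := (N.mkQ.toAddMonoidHom).comp (TensorProduct.mk R S P 1).toAddMonoidHom
  let ψ : B →+ P →+ Q :=
    { toFun := fun b => (DistribSMul.toAddMonoidHom Q (ev b)).comp β
      map_zero' := by ext p; simp
      map_add' := fun b c => by ext p; simp [add_smul] }
  have hψ : ∀ b p, ψ b p = ev b • N.mkQ (1 ⊗ₜ p) := fun _ _ => rfl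
  have hbal : ∀ (a : A) (b : B) (p : P), ψ (a • b) p = ψ b (a • p) := by
    intro a b p
    obtain ⟨r, hr⟩ := exists_sub_mem_pow _ hfg (max j k) a
    have h1 := hk _ (Ideal.pow_le_pow_right (le_max_right j k) hr) p
    rw [sub_smul, sub_eq_zero, algebraMap_smul] at h1
    have h2 := hevF _ hr
    rw [map_sub, map_sub, sub_eq_zero, hF] at h2
    have h3 : ev (algebraMap S B (algebraMap R S r)) =
      Ideal.Quotient.mk _ (algebraMap R S r) := ev.commutes _
    rw [hψ, hψ, Algebra.smul_def, map_mul, h2, h3, h1, mul_comm, mul_smul]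
    congr 1
    change N.mkQ (algebraMap R S r • ((1 : S) ⊗ₜ[R] p)) = _
    rw [algebraMap_smul, TensorProduct.tmul_smul]
  have h := congrArg (TensorProduct.liftAddHom ψ hbal) hx
  rw [TensorProduct.liftAddHom_tmul, map_zero, hψ, map_one, one_smul] at h
  rw [SModEq.zero]
  exact (Submodule.Quotient.mk_eq_zero N).mp h

end

/-- If `R → S` is a pure local homomorphism of Noetherian local rings, then the induced
map between the maximal-adic completions is pure. -/
theorem completion_of_pure_isPure (R S : Type u) [CommRing R] [CommRing S]
    [IsNoetherianRing R] [IsNoetherianRing S] [IsLocalRing R] [IsLocalRing S]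
    (f : R →+* S) (hloc : IsLocalHom f) (hf : f.IsPure)
    (F : AdicCompletion (IsLocalRing.maximalIdeal R) R →+*
        AdicCompletion (IsLocalRing.maximalIdeal S) S)
    (hF : F.comp (algebraMap R (AdicCompletion (IsLocalRing.maximalIdeal R) R)) =
        (algebraMap S (AdicCompletion (IsLocalRing.maximalIdeal S) S)).comp f) :
    F.IsPure := by
  letI : Algebra R S := f.toAlgebra
  letI : Algebra (AdicCompletion (IsLocalRing.maximalIdeal R) R)
    (AdicCompletion (IsLocalRing.maximalIdeal S) S) := F.toAlgebra
  intro M _ _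
  set A := AdicCompletion (IsLocalRing.maximalIdeal R) R with hA
  set B := AdicCompletion (IsLocalRing.maximalIdeal S) S with hB
  haveI : IsNoetherianRing A := adicCompletion_isNoetherianRing _
  change Function.Injective (TensorProduct.mk A B M 1)
  rw [injective_iff_map_eq_zero]
  intro x hx
  have hx' : x ⊗ₜ[A] (1 : B) = 0 := by
    have := congrArg (TensorProduct.comm A B M) hx
    simpa using this
  have hxm : x ∈ Submodule.span A {x} := Submodule.mem_span_singleton_self x
  obtain ⟨Q, hPQ, hQ, h0⟩ := TensorProduct.eq_zero_of_fg_of_subtype_eq_zero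
    (P := Submodule.span A {x}) (Submodule.fg_span_singleton x)
    (t := (⟨x, hxm⟩ : Submodule.span A {x}) ⊗ₜ[A] (1 : B)) (by simpa using hx')
  rw [LinearMap.rTensor_tmul] at h0
  let y : Q := Submodule.inclusion hPQ ⟨x, hxm⟩
  haveI : Module.Finite A Q := Module.Finite.iff_fg.mpr hQ
  suffices hy : y = 0 from congrArg Subtype.val hy
  have hy0 : (1 : B) ⊗ₜ[A] y = 0 := by
    have := congrArg (TensorProduct.comm A Q B) h0
    simpa using this
  refine IsHausdorff.haus (inferInstance : IsHausdorff (IsLocalRing.maximalIdeal A) Q) _ fun k => ?_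
  rw [SModEq.zero]
  let N : Submodule A Q := (IsLocalRing.maximalIdeal A) ^ k • ⊤
  letI : Module R (Q ⧸ N) := Module.compHom (Q ⧸ N) (algebraMap R A)
  haveI : IsScalarTower R A (Q ⧸ N) := ⟨fun r a p => by
    rw [Algebra.smul_def, mul_smul]; rfl⟩
  refine (Submodule.Quotient.mk_eq_zero N).mp ?_
  refine pure_key (R := R) (S := S) hloc (fun r => RingHom.congr_fun hF r) (Q ⧸ N)
    (hf (Q ⧸ N)) k ?_ (N.mkQ y) ?_
  · rw [← AdicCompletion.maximalIdeal_eq_map]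
    intro a ha p
    obtain ⟨p, rfl⟩ := N.mkQ_surjective p
    rw [← map_smul]
    exact (Submodule.Quotient.mk_eq_zero N).mpr (Submodule.smul_mem_smul ha trivial)
  · have := congrArg (N.mkQ.lTensor B) hy0
    simpa using this
end
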